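/- Let N ≥ 1, let a₁,…,a_N, b₁,…,b_N be positive reals, let μ > 0 and μₙ > 0 for each n, and set η = μ + Σₙ μₙ. Suppose y ∈ ℝᴺ satisfies yₙ ≥ μₙ for all n and Σₙ yₙ = η, and suppose there exist a real number λ and nonnegative reals γ₁,…,γ_N such that for every n: aₙyₙ + 2bₙ = (λ − γₙ)yₙ³ and γₙ(μₙ − yₙ) = 0. Then y is a global minimizer of F(y) = Σₙ (aₙ/yₙ + bₙ/yₙ²) over the feasible set {y : yₙ ≥ μₙ for all n, Σₙ yₙ = η}. -/

import Mathlib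

theorem kkt_sufficiency (N : ℕ) (hN : 1 ≤ N)
    (a b : Fin N → ℝ) (ha : ∀ n, 0 < a n) (hb : ∀ n, 0 < b n)
    (μ : ℝ) (hμ : 0 < μ) (μd : Fin N → ℝ) (hμd : ∀ n, 0 < μd n)
    (y : Fin N → ℝ) (hfeas : ∀ n, μd n ≤ y n)
    (hsum : ∑ n, y n = μ + ∑ n, μd n)
    (lam : ℝ) (γ : Fin N → ℝ) (hγ : ∀ n, 0 ≤ γ n)
    (hstat : ∀ n, a n * y n + 2 * b n = (lam - γ n) * (y n)^3)
    (hcomp : ∀ n, γ n * (μd n - y n) = 0) :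
    ∀ z : Fin N → ℝ, (∀ n, μd n ≤ z n) → ∑ n, z n = μ + ∑ n, μd n →
      ∑ n, (a n / y n + b n / (y n)^2) ≤ ∑ n, (a n / z n + b n / (z n)^2) := by
  intro z hz hzs
  have key : ∀ n, a n / y n + b n / (y n)^2 ≤
      a n / z n + b n / (z n)^2 + lam * (z n - y n) := by
    intro n
    have hy : 0 < y n := lt_of_lt_of_le (hμd n) (hfeas n)
    have hzp : 0 < z n := lt_of_lt_of_le (hμd n) (hz n)
    have han := ha n
    have hbn := hb n
    have h1 : 0 ≤ γ n * (z n - y n) := by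
      have h2 := mul_nonneg (hγ n) (sub_nonneg.2 (hz n))
      have h3 := hcomp n
      nlinarith
    have hlam : lam = (a n * y n + 2 * b n) / (y n)^3 + γ n := by
      rw [hstat n]
      field_simp
      ring
    have e : a n / z n + b n / (z n)^2 + lam * (z n - y n) - (a n / y n + b n / (y n)^2)
        = a n * (z n - y n)^2 / (z n * (y n)^2)
          + b n * ((z n - y n)^2 * (2 * z n + y n)) / ((z n)^2 * (y n)^3)
          + γ n * (z n - y n) := by
      rw [hlam]
      field_simp
      ring
    have p1 : 0 ≤ a n * (z n - y n)^2 / (z n * (y n)^2) := by positivity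
    have p2 : 0 ≤ b n * ((z n - y n)^2 * (2 * z n + y n)) / ((z n)^2 * (y n)^3) := by
      positivity
    linarith
  have h := Finset.sum_le_sum (fun n (_ : n ∈ Finset.univ) => key n)
  have h0 : ∑ n, lam * (z n - y n) = 0 := by
    rw [← Finset.mul_sum, Finset.sum_sub_distrib, hsum, hzs, sub_self, mul_zero]
  rw [Finset.sum_add_distrib (g := fun n => lam * (z n - y n)), h0, add_zero] at h
  exact h
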